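/- Let p be a prime and let (U, ∂₁, …, ∂_m) be a differential field of characteristic p with m pairwise commuting derivations. Let k ⊆ K and k ⊆ L ⊆ L₁ be differential subfields of U such that the field extensions k ⊆ K, k ⊆ L, L ⊆ L₁, K ⊆ U and L₁ ⊆ U are all separable, and such that K is both linearly disjoint from L₁ over k and algebraically independent from L₁ over k. Then every subset S of C_{KL}^{1/p} which is p-independent in C_{KL}^{1/p} over the compositum KL remains p-independent in C_{KL₁}^{1/p} over KL₁, where C_M^{1/p} = {x ∈ U : x^p ∈ C_M} for a differential subfield M of U. -/

import Mathlib

/-- The subfield generated by a subfield `k` and a subset `S` of the ambient field. -/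
def Subfield.adjoinSet {U : Type*} [Field U] (k : Subfield U) (S : Set U) : Subfield U :=
  Subfield.closure (↑k ∪ S)

/-- A subset `S` is separably independent over a subfield `K` if no `s ∈ S` is separably
algebraic over the subfield `K(S ∖ {s})`. -/
def SepIndepOver {U : Type*} [Field U] (K : Subfield U) (S : Set U) : Prop :=
  ∀ s ∈ S, ¬ IsSeparable (K.adjoinSet (S \ {s})) s

/-- A subset `B` is algebraically independent over a subfield `K` if no `b ∈ B` is
algebraic over the subfield `K(B ∖ {b})`. -/
def AlgIndepOver {U : Type*} [Field U] (K : Subfield U) (B : Set U) : Prop :=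
  ∀ b ∈ B, ¬ IsAlgebraic (K.adjoinSet (B \ {b})) b

/-- A subset `S` of a subfield `M` is `p`-independent in `M` over `k₀` if no `s ∈ S`
lies in the subfield `M^p · k₀(S ∖ {s})`. -/
def PIndepOver {U : Type*} [Field U] (p : ℕ) (k₀ M : Subfield U) (S : Set U) : Prop :=
  ∀ s ∈ S,
    s ∉ Subfield.closure ((fun x : U => x ^ p) '' (M : Set U) ∪ ↑k₀ ∪ (S \ {s}))

/-- `S` is a `p`-basis of `M` over `k₀`: a `p`-independent subset of `M` over `k₀` with
`M = M^p · k₀(S)`. -/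
def IsPBasis {U : Type*} [Field U] (p : ℕ) (k₀ M : Subfield U) (S : Set U) : Prop :=
  S ⊆ (M : Set U) ∧ PIndepOver p k₀ M S ∧
    Subfield.closure ((fun x : U => x ^ p) '' (M : Set U) ∪ ↑k₀ ∪ S) = M

/-- `K` is a differential subfield w.r.t. the commuting derivations `D i` on the
ambient field `U`: it is closed under each derivation. -/
def IsDiffSubfield {U : Type*} [Field U] {m : ℕ} (D : Fin m → Derivation ℤ U U)
    (K : Subfield U) : Prop :=
  ∀ i : Fin m, ∀ x ∈ K, D i x ∈ K

/-- The set of constants `C_K = {a ∈ K : Dᵢ a = 0 for all i}` of a differential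
subfield `K`. -/
def constSet {U : Type*} [Field U] {m : ℕ} (D : Fin m → Derivation ℤ U U)
    (K : Subfield U) : Set U :=
  {a : U | a ∈ K ∧ ∀ i : Fin m, D i a = 0}

/-- The subfield `C_K^{1/p} = {x ∈ U : x^p ∈ C_K}` of `p`-th roots of constants of `K`. -/
def pRootsConst {U : Type*} [Field U] {m : ℕ} (p : ℕ) (D : Fin m → Derivation ℤ U U)
    (K : Subfield U) : Subfield U :=
  Subfield.closure {x : U | x ^ p ∈ constSet D K}

/-- The set of all iterated derivatives `Dᵢ^j(a)`, for `a ∈ A`, `1 ≤ i ≤ m`, `j ≥ 0`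
(listed without repetitions, i.e. as a set). -/
def derivSet {U : Type*} [Field U] {m : ℕ} (D : Fin m → Derivation ℤ U U)
    (A : Set U) : Set U :=
  {x : U | ∃ a ∈ A, ∃ i : Fin m, ∃ j : ℕ, x = (fun y => D i y)^[j] a}

/-- `A` is separably differentially independent over `K`: the family of all iterated
derivatives of elements of `A` is separably independent over `K`. -/
def SepDiffIndepOver {U : Type*} [Field U] {m : ℕ} (D : Fin m → Derivation ℤ U U)
    (K : Subfield U) (A : Set U) : Prop :=
  SepIndepOver K (derivSet D A)

/-- `B` is differentially independent over `K`: the family of all iterated derivatives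
of elements of `B` is algebraically independent over `K`. -/
def DiffIndepOver {U : Type*} [Field U] {m : ℕ} (D : Fin m → Derivation ℤ U U)
    (K : Subfield U) (B : Set U) : Prop :=
  AlgIndepOver K (derivSet D B)

/-- The differential subfield `K⟨A⟩` generated by `A` over `K`: the smallest subfield
of `U` containing `K` and `A` and closed under all the derivations. -/
def diffAdjoin {U : Type*} [Field U] {m : ℕ} (D : Fin m → Derivation ℤ U U)
    (K : Subfield U) (A : Set U) : Subfield U :=
  sInf {M : Subfield U | K ≤ M ∧ A ⊆ (M : Set U) ∧ IsDiffSubfield D M}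

/-- `K` is differentially trap (differentially transcendentally almost perfect): there
is a `p`-basis of `C_K^{1/p}` over `K` which is separably differentially independent
over `K`. -/
def DiffTrap {U : Type*} [Field U] {m : ℕ} (p : ℕ) (D : Fin m → Derivation ℤ U U)
    (K : Subfield U) : Prop :=
  ∃ A : Set U, IsPBasis p K (pRootsConst p D K) A ∧ SepDiffIndepOver D K A
/-- The subfield of `p`-th powers of a subfield `K`. -/
def Subfield.pPow {U : Type*} [Field U] (p : ℕ) (K : Subfield U) : Subfield U :=
  Subfield.closure ((fun x : U => x ^ p) '' (K : Set U))

/-- `K₁` is linearly disjoint from `K₂` over a common subfield `k₀`: every subset of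
`K₁` which is `k₀`-linearly independent remains `K₂`-linearly independent. -/
def LinDisjOver {U : Type*} [Field U] (k₀ K₁ K₂ : Subfield U) : Prop :=
  ∀ S : Set U, S ⊆ (K₁ : Set U) →
    LinearIndependent k₀ (Subtype.val : S → U) →
    LinearIndependent K₂ (Subtype.val : S → U)

/-- The extension `k ⊆ K` (in characteristic `p`) is separable if `k` is linearly
disjoint from `K^p` over `k^p`. -/
def SepExt {U : Type*} [Field U] (p : ℕ) (k K : Subfield U) : Prop :=
  LinDisjOver (k.pPow p) k (K.pPow p)

/-- `K` is algebraically independent (free) from `L` over `k`: every subset of `K`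
algebraically independent over `k` remains algebraically independent over `L`. -/
def AlgIndepFrom {U : Type*} [Field U] (k K L : Subfield U) : Prop :=
  ∀ S : Set U, S ⊆ (K : Set U) → AlgIndepOver k S → AlgIndepOver L S

/-- Finitely many elements of the field generated by `A` have a common denominator in the
ring generated by `A`. -/
theorem Subfield.exists_common_denom {U ι : Type*} [Field U] (A : Set U) (s : Finset ι)
    (x : ι → U) (hx : ∀ i ∈ s, x i ∈ Subfield.closure A) :
    ∃ z ∈ Subring.closure A, z ≠ 0 ∧ ∀ i ∈ s, z * x i ∈ Subring.closure A := by
  classical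
  induction s using Finset.induction_on with
  | empty => exact ⟨1, one_mem _, one_ne_zero, by simp⟩
  | insert a s ha ih =>
    obtain ⟨z, hz, hz0, hzx⟩ := ih fun i hi => hx i (Finset.mem_insert_of_mem hi)
    obtain ⟨y, hy, w, hw, hyw⟩ := Subfield.mem_closure_iff.1 (hx a (Finset.mem_insert_self a s))
    by_cases hw0 : w = 0
    · refine ⟨z, hz, hz0, fun i hi => ?_⟩
      rcases Finset.mem_insert.1 hi with rfl | hi
      · simp [← hyw, hw0]
      · exact hzx i hi
    · refine ⟨z * w, mul_mem hz hw, mul_ne_zero hz0 hw0, fun i hi => ?_⟩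
      rcases Finset.mem_insert.1 hi with rfl | hi
      · rw [← hyw, mul_assoc, mul_div_cancel₀ _ hw0]
        exact mul_mem hz hy
      · rw [mul_right_comm]
        exact mul_mem (hzx i hi) hw

/-- The ring generated by two subfields `K` and `F` is contained in the `F`-span of any set
whose span over some subfield of `F` contains `K`. -/
theorem Subring.closure_union_subset_span {U : Type*} [Field U] {k₀ K F : Subfield U}
    (hk₀F : k₀ ≤ F) {E : Set U} (hE : (K : Set U) ⊆ Submodule.span k₀ E) :
    (Subring.closure ((K : Set U) ∪ F) : Set U) ⊆ Submodule.span F E := by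
  have hKE : (K : Set U) ⊆ Submodule.span F E := fun x hx => by
    refine Submodule.span_induction (p := fun y _ => y ∈ Submodule.span F E)
      (fun y hy => Submodule.subset_span hy) (zero_mem _) (fun _ _ _ _ => add_mem)
      (fun a y _ hy => ?_) (hE hx)
    exact Submodule.smul_mem _ (⟨a, hk₀F a.2⟩ : F) hy
  have hadj : Subalgebra.toSubmodule (Algebra.adjoin F (K : Set U)) ≤ Submodule.span F E := by
    rw [Algebra.adjoin_eq_span, Submodule.span_le]
    have : Submonoid.closure (K : Set U) ≤ K.toSubmonoid := Submonoid.closure_le.2 fun _ h => h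
    exact fun x hx => hKE (this hx)
  have hle : Subring.closure ((K : Set U) ∪ F) ≤ (Algebra.adjoin F (K : Set U)).toSubring := by
    rw [Subring.closure_le]
    rintro x (hx | hx)
    · exact Algebra.subset_adjoin hx
    · exact (Algebra.adjoin F (K : Set U)).algebraMap_mem ⟨x, hx⟩
  exact fun x hx => hadj (hle hx)

/-- Finitely many elements of a compositum `K ⊔ F` have, up to a common nonzero factor,
coordinates in `F` with respect to any set whose span over a subfield of `F` contains `K`. -/
theorem Subfield.exists_coords_of_mem_sup {U ι : Type*} [Field U] {k₀ K F : Subfield U}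
    (hk₀F : k₀ ≤ F) {E : Set U} (hE : (K : Set U) ⊆ Submodule.span k₀ E) (s : Finset ι)
    (x : ι → U) (hx : ∀ i ∈ s, x i ∈ K ⊔ F) :
    ∃ (z : E →₀ F) (l : ι → E →₀ F) (t : Finset E),
      ∑ e ∈ t, (z e : U) * e ≠ 0 ∧
      ∀ i ∈ s, (∑ e ∈ t, (z e : U) * e) * x i = ∑ e ∈ t, (l i e : U) * e := by
  classical
  obtain ⟨w, hw, hw0, hwx⟩ := Subfield.exists_common_denom ((K : Set U) ∪ F) s x fun i hi => by
    rw [Subfield.closure_union, Subfield.closure_eq, Subfield.closure_eq]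
    exact hx i hi
  have hspan := Subring.closure_union_subset_span hk₀F hE
  have hrepr : ∀ y ∈ Subring.closure ((K : Set U) ∪ F), ∃ l : E →₀ F,
      Finsupp.linearCombination F (Subtype.val : E → U) l = y := fun y hy =>
    (Finsupp.mem_span_iff_linearCombination F E y).1 (hspan hy)
  obtain ⟨z, hz⟩ := hrepr w hw
  have hl : ∀ i, ∃ l : E →₀ F, i ∈ s →
      Finsupp.linearCombination F (Subtype.val : E → U) l = w * x i := fun i => by
    by_cases hi : i ∈ s
    · obtain ⟨l, hl⟩ := hrepr _ (hwx i hi)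
      exact ⟨l, fun _ => hl⟩
    · exact ⟨0, fun h => absurd h hi⟩
  choose l hl using hl
  have hsum : ∀ (f : E →₀ F) (t : Finset E), f.support ⊆ t →
      Finsupp.linearCombination F (Subtype.val : E → U) f = ∑ e ∈ t, (f e : U) * e :=
    fun f t ht => by
      rw [Finsupp.linearCombination_apply, Finsupp.sum_of_support_subset f ht _ (by simp)]
      rfl
  set t : Finset E := z.support ∪ s.biUnion fun i => (l i).support
  have hzt := hsum z t Finset.subset_union_left
  refine ⟨z, l, t, ?_, fun i hi => ?_⟩
  · rwa [← hzt, hz]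
  · rw [← hzt, hz, ← hl i hi]
    exact hsum _ _ ((Finset.subset_biUnion_of_mem (fun i => (l i).support) hi).trans
      Finset.subset_union_right)

/-- If `K` is linearly disjoint from `K₂` over `k₀` and `k₀ ≤ F ≤ K₂`, then families in `K₂`
that are linearly independent over `F` stay so over the compositum `K ⊔ F`. -/
theorem LinDisjOver.linearIndependent_sup {U ι : Type*} [Field U] {k₀ K K₂ F : Subfield U}
    (h : LinDisjOver k₀ K K₂) (hk₀F : k₀ ≤ F) (hF : F ≤ K₂) {x : ι → U}
    (hx : ∀ i, x i ∈ K₂) (hli : LinearIndependent F x) :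
    LinearIndependent (K ⊔ F : Subfield U) x := by
  obtain ⟨E, hEK, hE, hEli⟩ := exists_linearIndependent k₀ (K : Set U)
  have hEK₂ := h E hEK hEli
  rw [linearIndependent_iff'] at hli hEK₂ ⊢
  intro s g hg
  obtain ⟨z, l, t, hz0, hl⟩ := Subfield.exists_coords_of_mem_sup hk₀F
    (hE.symm ▸ Submodule.subset_span) s (fun i => (g i : U)) fun i _ => (g i).2
  have hcoef : ∀ e ∈ t, ∑ i ∈ s, (l i e : U) * x i = 0 := by
    have := hEK₂ t (fun e => ∑ i ∈ s, ⟨l i e, hF (l i e).2⟩ * ⟨x i, hx i⟩) (by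
      have hg' : ∑ i ∈ s, (g i : U) * x i = 0 := hg
      simp only [Subfield.smul_def, AddSubmonoidClass.coe_finsetSum, MulMemClass.coe_mul,
        smul_eq_mul, Finset.sum_mul]
      rw [Finset.sum_comm]
      calc _ = ∑ i ∈ s, (∑ e ∈ t, (l i e : U) * e) * x i := by
            simp only [Finset.sum_mul, mul_right_comm]
        _ = ∑ i ∈ s, (∑ e ∈ t, (z e : U) * e) * ((g i : U) * x i) :=
            Finset.sum_congr rfl fun i hi => by rw [← hl i hi, mul_assoc]
        _ = 0 := by rw [← Finset.mul_sum, hg', mul_zero])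
    intro e he
    simpa using congrArg (Subtype.val : K₂ → U) (this e he)
  intro i hi
  have hl0 : ∀ e ∈ t, l i e = 0 := fun e he => hli s (fun i => l i e) (hcoef e he) i hi
  have := hl i hi
  rw [Finset.sum_eq_zero (s := t) (f := fun e => (l i e : U) * e)
    fun e he => by simp [hl0 e he]] at this
  exact Subtype.ext ((mul_eq_zero.1 this).resolve_left hz0)

theorem Subfield.mem_pPow_iff {U : Type*} [Field U] {p : ℕ} [Fact p.Prime] [CharP U p]
    {K : Subfield U} {x : U} : x ∈ K.pPow p ↔ ∃ y ∈ K, y ^ p = x := by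
  have : K.pPow p = K.map (frobenius U p) := by
    rw [← Subfield.closure_eq (K.map (frobenius U p))]
    rfl
  rw [this, Subfield.mem_map]
  rfl

/-- Raising to the `p`-th power turns linear independence over `L` into linear independence
over `L ^ p`. -/
theorem LinearIndependent.pow_pPow {U ι : Type*} [Field U] {p : ℕ} [Fact p.Prime] [CharP U p]
    {L : Subfield U} {x : ι → U} (hx : LinearIndependent L x) :
    LinearIndependent (L.pPow p) fun i => x i ^ p := by
  rw [linearIndependent_iff'] at hx ⊢
  intro s g hg i hi
  choose f hfL hf using fun i => Subfield.mem_pPow_iff.1 (g i).2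
  have hsum : (∑ i ∈ s, f i * x i) ^ p = 0 := by
    rw [sum_pow_char]
    simp only [mul_pow, hf]
    exact hg
  have h0 := hx s (fun i => ⟨f i, hfL i⟩)
    (eq_zero_of_pow_eq_zero hsum) i hi
  have : f i = 0 := congrArg Subtype.val h0
  exact Subtype.ext (by rw [← hf i, this, zero_pow (Fact.out : p.Prime).ne_zero]; rfl)

/-- If `L₁` is separable over `L` and `K` is linearly disjoint from `L₁` over `k`, then a linear
relation among elements of `K ⊔ L` with coefficients that are `p`-th powers of elements of
`K ⊔ L₁` yields one with coefficients that are `p`-th powers of elements of `K ⊔ L`. -/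
theorem exists_pow_coeffs_of_linDisj {U ι : Type*} [Field U] {p : ℕ} [Fact p.Prime] [CharP U p]
    {k K L L₁ : Subfield U} (hkL : k ≤ L) (hLL₁ : L ≤ L₁) (hsLL₁ : SepExt p L L₁)
    (hld : LinDisjOver k K L₁) (s : Finset ι) (a₀ : U) (a m : ι → U)
    (ha₀ : a₀ ∈ K ⊔ L) (ha : ∀ i ∈ s, a i ∈ K ⊔ L) (hm : ∀ i ∈ s, m i ∈ K ⊔ L₁)
    (heq : a₀ = ∑ i ∈ s, m i ^ p * a i) :
    ∃ n : ι → U, (∀ i, n i ∈ K ⊔ L) ∧ a₀ = ∑ i ∈ s, n i ^ p * a i := by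
  obtain ⟨B, hBL₁, hB, hBli⟩ := exists_linearIndependent L (L₁ : Set U)
  have hpow_le : L.pPow p ≤ L := fun x hx => by
    obtain ⟨y, hy, rfl⟩ := Subfield.mem_pPow_iff.1 hx
    exact pow_mem hy p
  have hBL : LinearIndependent L fun b : B => (b : U) ^ p := by
    have := LinDisjOver.linearIndependent_sup hsLL₁ le_rfl
      (fun x hx => by
        obtain ⟨y, hy, rfl⟩ := Subfield.mem_pPow_iff.1 hx
        exact Subfield.mem_pPow_iff.2 ⟨y, hLL₁ hy, rfl⟩)
      (fun b : B => Subfield.mem_pPow_iff.2 ⟨b, hBL₁ b.2, rfl⟩) (hBli.pow_pPow (p := p))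
    rwa [sup_eq_left.2 hpow_le] at this
  have hBM := hld.linearIndependent_sup hkL hLL₁ (fun b : B => pow_mem (hBL₁ b.2) p) hBL
  obtain ⟨z, l, t, hz0, hl⟩ := Subfield.exists_coords_of_mem_sup (F := K ⊔ L)
    (le_sup_right : L ≤ K ⊔ L) (hE := hB.symm ▸ Submodule.subset_span) s m fun i hi =>
      (sup_le (le_sup_left.trans le_sup_right) le_sup_left : K ⊔ L₁ ≤ L₁ ⊔ (K ⊔ L)) (hm i hi)
  obtain ⟨b, hb, hzb⟩ : ∃ b ∈ t, z b ≠ 0 := by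
    by_contra! hcon
    exact hz0 (Finset.sum_eq_zero fun b hb => by simp [hcon b hb])
  have hrel : ∑ b ∈ t, ((z b : U) ^ p * a₀ - ∑ i ∈ s, (l i b : U) ^ p * a i) * (b : U) ^ p = 0 := by
    have h1 : (∑ b ∈ t, (z b : U) * b) ^ p * a₀ =
        ∑ i ∈ s, (∑ b ∈ t, (l i b : U) * b) ^ p * a i := by
      rw [heq, Finset.mul_sum]
      exact Finset.sum_congr rfl fun i hi => by rw [← hl i hi, mul_pow, mul_assoc]
    simp only [sum_pow_char, mul_pow, Finset.sum_mul] at h1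
    rw [Finset.sum_comm] at h1
    simp only [sub_mul, Finset.sum_mul, Finset.sum_sub_distrib, mul_right_comm _ _ ((_ : U) ^ p)]
    exact sub_eq_zero.2 h1
  have hmem : ∀ b : B, (z b : U) ^ p * a₀ - ∑ i ∈ s, (l i b : U) ^ p * a i ∈ K ⊔ L := fun b =>
    sub_mem (mul_mem (pow_mem (z b).2 p) ha₀)
      (sum_mem fun i hi => mul_mem (pow_mem (l i b).2 p) (ha i hi))
  have hb0 : (z b : U) ^ p * a₀ - ∑ i ∈ s, (l i b : U) ^ p * a i = 0 :=
    congrArg Subtype.val (linearIndependent_iff'.1 hBM t (fun b => ⟨_, hmem b⟩) hrel b hb)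
  have hzb' : (z b : U) ≠ 0 := fun h => hzb (Subtype.ext h)
  refine ⟨fun i => l i b / z b, fun i => div_mem (l i b).2 (z b).2, ?_⟩
  simp only [div_pow, div_mul_eq_mul_div]
  rw [← Finset.sum_div, eq_div_iff (pow_ne_zero p hzb'), mul_comm]
  exact sub_eq_zero.1 hb0

/-- A field generated over `M` by `p`-th roots of elements of `M` is the `M`-span of the
monomials in these generators. -/
theorem Subfield.closure_union_subset_span_monomials {U : Type*} [Field U] {p : ℕ}
    [Fact p.Prime] [CharP U p] (M : Subfield U) (T : Set U) (hT : ∀ t ∈ T, t ^ p ∈ M) :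
    (Subfield.closure ((M : Set U) ∪ T) : Set U) ⊆
      Submodule.span M (Submonoid.closure T : Set U) := by
  have hp0 : p ≠ 0 := (Fact.out : p.Prime).ne_zero
  rw [← Algebra.adjoin_eq_span]
  have key : ∀ x ∈ Subfield.closure ((M : Set U) ∪ T),
      x ∈ Algebra.adjoin M T ∧ x ^ p ∈ M := fun x hx => by
    induction hx using Subfield.closure_induction with
    | mem x hx =>
      rcases hx with hx | hx
      · exact ⟨(Algebra.adjoin M T).algebraMap_mem ⟨x, hx⟩, pow_mem hx p⟩
      · exact ⟨Algebra.subset_adjoin hx, hT x hx⟩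
    | one => exact ⟨one_mem _, by simp [one_mem]⟩
    | add x y _ _ hx hy => exact ⟨add_mem hx.1 hy.1, by rw [add_pow_char]; exact add_mem hx.2 hy.2⟩
    | neg x _ hx =>
      refine ⟨neg_mem hx.1, ?_⟩
      rw [neg_pow]
      exact mul_mem (pow_mem (neg_mem (one_mem M)) p) hx.2
    | inv x _ hx =>
      refine ⟨?_, by rw [inv_pow]; exact inv_mem hx.2⟩
      by_cases h0 : x = 0
      · simp [h0]
      have : x⁻¹ = x ^ (p - 1) * (x ^ p)⁻¹ := by
        rw [← pow_sub_one_mul hp0 x]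
        field_simp
      rw [this]
      exact mul_mem (pow_mem hx.1 _) ((Algebra.adjoin M T).algebraMap_mem ⟨_, inv_mem hx.2⟩)
    | mul x y _ _ hx hy =>
      exact ⟨mul_mem hx.1 hy.1, by rw [mul_pow]; exact mul_mem hx.2 hy.2⟩
  exact fun x hx => (key x hx).1

theorem pow_mem_of_mem_pRootsConst {U : Type*} [Field U] {m p : ℕ} [Fact p.Prime] [CharP U p]
    {D : Fin m → Derivation ℤ U U} {M : Subfield U} {x : U} (hx : x ∈ pRootsConst p D M) :
    x ^ p ∈ M := by
  have : pRootsConst p D M ≤ M.comap (frobenius U p) := Subfield.closure_le.2 fun y hy => hy.1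
  exact this hx

/-- Let `k ⊆ K` and `k ⊆ L ⊆ L₁` be differential subfields of `U` with the separability
assumptions of the statement, and with `K` linearly disjoint from and algebraically
independent from `L₁` over `k`. Then every subset `S ⊆ C_{KL}^{1/p}` which is
`p`-independent in `C_{KL}^{1/p}` over `KL` remains `p`-independent in `C_{KL₁}^{1/p}`
over `KL₁`. -/
theorem pIndep_extends_of_linDisj
    {p m : ℕ} (hp : p.Prime) (hm : 0 < m) {U : Type*} [Field U] [CharP U p]
    (D : Fin m → Derivation ℤ U U)
    (hcomm : ∀ i j : Fin m, ∀ x : U, D i (D j x) = D j (D i x))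
    (k K L L₁ : Subfield U)
    (hk : IsDiffSubfield D k) (hK : IsDiffSubfield D K)
    (hL : IsDiffSubfield D L) (hL₁ : IsDiffSubfield D L₁)
    (hkK : k ≤ K) (hkL : k ≤ L) (hLL₁ : L ≤ L₁)
    (hsK : SepExt p k K) (hsL : SepExt p k L) (hsLL₁ : SepExt p L L₁)
    (hsKU : SepExt p K ⊤) (hsL₁U : SepExt p L₁ ⊤)
    (hld : LinDisjOver k K L₁) (hfree : AlgIndepFrom k K L₁) :
    ∀ S : Set U, S ⊆ (pRootsConst p D (K ⊔ L) : Set U) →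
      PIndepOver p (K ⊔ L) (pRootsConst p D (K ⊔ L)) S →
      PIndepOver p (K ⊔ L₁) (pRootsConst p D (K ⊔ L₁)) S := by
  intro S hS hind s hs hmem
  have : Fact p.Prime := ⟨hp⟩
  refine hind s hs (Subfield.closure_mono
    (Set.union_subset_union_left _ Set.subset_union_right) ?_)
  have hSM : ∀ t ∈ S, t ^ p ∈ K ⊔ L := fun t ht => pow_mem_of_mem_pRootsConst (hS ht)
  have hMM₁ : K ⊔ L ≤ K ⊔ L₁ := sup_le_sup_left hLL₁ K
  have hroots : (fun x : U => x ^ p) '' (pRootsConst p D (K ⊔ L₁) : Set U) ∪ ↑(K ⊔ L₁) =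
      ((K ⊔ L₁ : Subfield U) : Set U) := by
    rw [Set.union_eq_right]
    rintro _ ⟨x, hx, rfl⟩
    exact pow_mem_of_mem_pRootsConst hx
  rw [hroots] at hmem
  have hspan := Subfield.closure_union_subset_span_monomials (K ⊔ L₁) (S \ {s})
    (fun t ht => hMM₁ (hSM t ht.1)) hmem
  obtain ⟨c, hc⟩ := (Finsupp.mem_span_iff_linearCombination _ _ _).1 hspan
  have hc' : s = ∑ e ∈ c.support, (c e : U) * e := hc.symm
  have hpow : s ^ p = ∑ e ∈ c.support, (c e : U) ^ p * (e : U) ^ p := by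
    conv_lhs => rw [hc', sum_pow_char]
    simp only [mul_pow]
  have hmon : Submonoid.closure (S \ {s}) ≤ ((K ⊔ L).comap (frobenius U p)).toSubmonoid :=
    Submonoid.closure_le.2 fun t ht => hSM t ht.1
  obtain ⟨n, hn, hsn⟩ := exists_pow_coeffs_of_linDisj hkL hLL₁ hsLL₁ hld c.support (s ^ p)
    (fun e => (e : U) ^ p) (fun e => (c e : U)) (hSM s hs) (fun e _ => hmon e.2)
    (fun e _ => (c e).2) hpow
  have hs_eq : s = ∑ e ∈ c.support, n e * e := by
    apply frobenius_inj U p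
    simp only [frobenius_def, sum_pow_char, mul_pow]
    exact hsn
  have hmon' : Submonoid.closure (S \ {s}) ≤
      (Subfield.closure (((K ⊔ L : Subfield U) : Set U) ∪ S \ {s})).toSubmonoid :=
    Submonoid.closure_le.2 fun t ht => Subfield.subset_closure (Or.inr ht)
  have hsum : ∑ e ∈ c.support, n e * e ∈
      Subfield.closure (((K ⊔ L : Subfield U) : Set U) ∪ S \ {s}) :=
    sum_mem fun e _ => mul_mem (Subfield.subset_closure (Or.inl (hn e))) (hmon' e.2)
  rwa [← hs_eq] at hsum
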